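/- arXiv:2111.07851 — 2 statements merged into one kernel-verified Lean document; each statement's English description precedes it below -/
import Mathlib

section
/- Let X be a complex Banach space, let φ ∈ (0, π), and let T : closure(Σ_{π−φ}) → B(X) be an operator-valued function that is continuous on the closure of the sector Σ_{π−φ} and holomorphic on Σ_{π−φ}. Fix p ∈ [1, ∞) and suppose the family {T(λ) : λ ∈ Σ_{π−φ}} is R-bounded with R_p-bound C < ∞. Then for every φ′ ∈ (φ, π) the family {λ · T′(λ) : λ ∈ Σ_{π−φ′}} (where T′ denotes the complex derivative of T) is R-bounded with R_p-bound at most C / sin²(φ′ − φ). Consequently, for every k ∈ ℕ and every φ′ ∈ (φ, π), the family {λ^k · T^{(k)}(λ) : λ ∈ Σ_{π−φ′}} is R-bounded. -/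
open scoped BigOperators

noncomputable section

/-- The discrete Rademacher average `(2^{-N} ∑_{ε ∈ {−1,1}^N} ‖∑_ν ε_ν v_ν‖^p)^{1/p}`. -/
def radAvg {Y : Type*} [NormedAddCommGroup Y] (p : ℝ) {N : ℕ} (v : Fin N → Y) : ℝ :=
  (((2 : ℝ) ^ N)⁻¹ * ∑ ε : Fin N → Bool, ‖∑ ν, (if ε ν then v ν else -v ν)‖ ^ p) ^ p⁻¹

/-- A family `T` of bounded operators is R-bounded with `R_p`-bound at most `C`. -/
def IsRBoundedWith {X Y : Type*} [NormedAddCommGroup X] [NormedSpace ℂ X]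
    [NormedAddCommGroup Y] [NormedSpace ℂ Y]
    (p : ℝ) (T : Set (X →L[ℂ] Y)) (C : ℝ) : Prop :=
  ∀ (N : ℕ) (t : Fin N → X →L[ℂ] Y), (∀ ν, t ν ∈ T) → ∀ x : Fin N → X,
    radAvg p (fun ν => t ν (x ν)) ≤ C * radAvg p x

/-- A family of bounded operators is R-bounded. -/
def IsRBounded {X Y : Type*} [NormedAddCommGroup X] [NormedSpace ℂ X]
    [NormedAddCommGroup Y] [NormedSpace ℂ Y] (p : ℝ) (T : Set (X →L[ℂ] Y)) : Prop :=
  ∃ C, 0 ≤ C ∧ IsRBoundedWith p T C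

/-- The open sector `Σ_θ = {z ≠ 0 : |arg z| < θ}`. -/
def sector (θ : ℝ) : Set ℂ := {z | z ≠ 0 ∧ |Complex.arg z| < θ}

/-- The signed sums `ε ↦ ∑ ν, ε ν • v ν` as a continuous linear map into `ℓ^q`, through which
Rademacher averages become norms. -/
def radSum (Y : Type*) [NormedAddCommGroup Y] [NormedSpace ℂ Y] (q : ENNReal) [Fact (1 ≤ q)]
    (N : ℕ) : (Fin N → Y) →L[ℂ] PiLp q (fun _ : Fin N → Bool => Y) :=
  (PiLp.continuousLinearEquiv q ℂ (fun _ : Fin N → Bool => Y)).symm.toContinuousLinearMap.comp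
    (ContinuousLinearMap.pi fun ε => ∑ ν, if ε ν then ContinuousLinearMap.proj ν
      else -ContinuousLinearMap.proj ν)

lemma radSum_apply {Y : Type*} [NormedAddCommGroup Y] [NormedSpace ℂ Y] (q : ENNReal)
    [Fact (1 ≤ q)] {N : ℕ} (v : Fin N → Y) (ε : Fin N → Bool) :
    radSum Y q N v ε = ∑ ν, if ε ν then v ν else -v ν := by
  simp only [radSum, ContinuousLinearMap.comp_apply, ContinuousLinearEquiv.coe_coe,
    PiLp.coe_symm_continuousLinearEquiv, ContinuousLinearMap.coe_pi',
    sum_apply]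
  refine Finset.sum_congr rfl fun ν _ => ?_
  split_ifs <;> simp

lemma radAvg_eq_norm_radSum {Y : Type*} [NormedAddCommGroup Y] [NormedSpace ℂ Y] {p : ℝ}
    (hp : 1 ≤ p) [Fact (1 ≤ ENNReal.ofReal p)] {N : ℕ} (v : Fin N → Y) :
    radAvg p v = (((2 : ℝ) ^ N)⁻¹) ^ p⁻¹ * ‖radSum Y (ENNReal.ofReal p) N v‖ := by
  have hp0 : 0 < p := by linarith
  have hq : (ENNReal.ofReal p).toReal = p := ENNReal.toReal_ofReal hp0.le
  rw [PiLp.norm_eq_sum (by rw [hq]; exact hp0), hq, radAvg, Real.mul_rpow (by positivity)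
    (Finset.sum_nonneg fun _ _ => by positivity)]
  simp only [radSum_apply, one_div]

/-- The Cauchy estimate for Rademacher averages. -/
lemma radAvg_iteratedDeriv_le {Y : Type*} [NormedAddCommGroup Y] [NormedSpace ℂ Y]
    [CompleteSpace Y] {p : ℝ} (hp : 1 ≤ p) {N : ℕ} {F : Fin N → ℂ → Y} {U : Set ℂ}
    (hU : IsOpen U) (hF : ∀ ν, DifferentiableOn ℂ (F ν) U) {c : ℂ} {r M : ℝ} (hr : 0 < r)
    (hc : Metric.closedBall c r ⊆ U)
    (hM : ∀ z ∈ Metric.sphere c r, radAvg p (fun ν => F ν z) ≤ M) (k : ℕ) :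
    radAvg p (fun ν => iteratedDeriv k (F ν) c) ≤ k.factorial * M / r ^ k := by
  have : Fact (1 ≤ ENNReal.ofReal p) := ⟨by simpa using ENNReal.ofReal_le_ofReal hp⟩
  set J := radSum Y (ENNReal.ofReal p) N
  have ha : (0 : ℝ) < (((2 : ℝ) ^ N)⁻¹) ^ p⁻¹ := by positivity
  set a := (((2 : ℝ) ^ N)⁻¹) ^ p⁻¹
  have hd : DifferentiableOn ℂ (fun z ν => F ν z) U := differentiableOn_pi.2 hF
  have hcU : c ∈ U := hc (Metric.mem_closedBall_self hr.le)
  have hcd : ContDiffAt ℂ k (fun z ν => F ν z) c :=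
    (hd.contDiffOn hU).contDiffAt (hU.mem_nhds hcU)
  have hJd : DifferentiableOn ℂ (fun z => J fun ν => F ν z) U :=
    J.differentiable.comp_differentiableOn hd
  have hderiv : iteratedDeriv k (fun z => J fun ν => F ν z) c =
      J fun ν => iteratedDeriv k (F ν) c := by
    have h1 : iteratedDeriv k (fun z => J fun ν => F ν z) c =
        J (iteratedDeriv k (fun z ν => F ν z) c) := by
      have := J.iteratedFDeriv_comp_left hcd (i := k) le_rfl
      simp only [iteratedDeriv]
      exact congrArg (fun m => m fun _ => 1) this
    rw [h1]
    congr 1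
    ext ν
    have := (ContinuousLinearMap.proj (R := ℂ) (φ := fun _ : Fin N => Y) ν).iteratedFDeriv_comp_left
      hcd (i := k) le_rfl
    simp only [iteratedDeriv]
    exact (congrArg (fun m => m fun _ => 1) this).symm
  have hb := Complex.norm_iteratedDeriv_le_of_forall_mem_sphere_norm_le (C := a⁻¹ * M) k hr
    (hJd.mono (closure_minimal Metric.ball_subset_closedBall
      Metric.isClosed_closedBall |>.trans hc)).diffContOnCl (fun z hz => by
      have := hM z hz
      rw [radAvg_eq_norm_radSum hp] at this
      rwa [le_inv_mul_iff₀ ha])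
  rw [hderiv] at hb
  rw [radAvg_eq_norm_radSum hp]
  calc a * ‖J fun ν => iteratedDeriv k (F ν) c‖
      ≤ a * (k.factorial * (a⁻¹ * M) / r ^ k) := by gcongr
    _ = k.factorial * M / r ^ k := by field_simp

/-- The Cauchy estimate for curves with values in an R-bounded family. -/
lemma IsRBoundedWith.radAvg_iteratedDeriv_le {X Y : Type*} [NormedAddCommGroup X]
    [NormedSpace ℂ X] [NormedAddCommGroup Y] [NormedSpace ℂ Y] [CompleteSpace Y] {p : ℝ}
    (hp : 1 ≤ p) {𝒯 : Set (X →L[ℂ] Y)} {C : ℝ} (h : IsRBoundedWith p 𝒯 C) {N : ℕ}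
    {S : Fin N → ℂ → X →L[ℂ] Y} {U : Set ℂ} (hU : IsOpen U)
    (hS : ∀ ν, DifferentiableOn ℂ (S ν) U) {c : ℂ} {r : ℝ} (hr : 0 < r)
    (hc : Metric.closedBall c r ⊆ U) (hmem : ∀ ν, ∀ z ∈ U, S ν z ∈ 𝒯) (k : ℕ)
    (x : Fin N → X) :
    radAvg p (fun ν => iteratedDeriv k (S ν) c (x ν)) ≤
      k.factorial * C / r ^ k * radAvg p x := by
  have hderiv : ∀ ν, iteratedDeriv k (fun z => S ν z (x ν)) c =
      iteratedDeriv k (S ν) c (x ν) := fun ν => by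
    have := (ContinuousLinearMap.apply ℂ Y (x ν)).iteratedFDeriv_comp_left
      (((hS ν).contDiffOn hU).contDiffAt (n := k)
        (hU.mem_nhds (hc (Metric.mem_closedBall_self hr.le)))) (i := k) le_rfl
    simp only [iteratedDeriv]
    exact congrArg (fun m => m fun _ => 1) this
  have := _root_.radAvg_iteratedDeriv_le hp hU (F := fun ν z => S ν z (x ν))
    (fun ν => (ContinuousLinearMap.apply ℂ Y (x ν)).differentiable.comp_differentiableOn (hS ν))
    hr hc (M := C * radAvg p x)
    (fun z hz => h N (fun ν => S ν z)
      (fun ν => hmem ν z (hc (Metric.sphere_subset_closedBall hz))) x) k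
  simp only [hderiv] at this
  exact this.trans_eq (by ring)

lemma isOpen_sector {θ : ℝ} (hθ : θ ≤ Real.pi) : IsOpen (sector θ) := by
  have h : sector θ = Complex.slitPlane ∩ (fun z => |Complex.arg z|) ⁻¹' Set.Iio θ := by
    ext z
    simp only [sector, Set.mem_ofPred_eq, Set.mem_inter_iff, Set.mem_preimage, Set.mem_Iio,
      Complex.mem_slitPlane_iff_arg]
    constructor
    · rintro ⟨h0, h1⟩
      refine ⟨⟨fun h => ?_, h0⟩, h1⟩
      rw [h, abs_of_pos Real.pi_pos] at h1
      linarith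
    · rintro ⟨⟨_, h0⟩, h1⟩
      exact ⟨h0, h1⟩
  rw [h]
  exact ContinuousOn.isOpen_inter_preimage
    (fun z hz => (Complex.continuousAt_arg hz).abs.continuousWithinAt)
    Complex.isOpen_slitPlane isOpen_Iio

lemma mul_mem_sector {θ₁ θ₂ : ℝ} (h : θ₁ + θ₂ ≤ Real.pi) {z w : ℂ} (hz : z ∈ sector θ₁)
    (hw : w ∈ sector θ₂) : z * w ∈ sector (θ₁ + θ₂) := by
  obtain ⟨hz0, hz⟩ := hz
  obtain ⟨hw0, hw⟩ := hw
  rw [abs_lt] at hz hw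
  refine ⟨mul_ne_zero hz0 hw0, ?_⟩
  rw [Complex.arg_mul hz0 hw0 ⟨by linarith, by linarith⟩, abs_lt]
  constructor <;> linarith

lemma exp_mem_sector {θ : ℝ} (hθ : θ ≤ Real.pi) {z : ℂ} (hz : |z.im| < θ) :
    Complex.exp z ∈ sector θ := by
  refine ⟨Complex.exp_ne_zero z, ?_⟩
  have h := abs_lt.1 hz
  rwa [← Complex.log_im, Complex.log_exp (by linarith) (by linarith)]

lemma iteratedDeriv_comp_mul_left {𝕜 F : Type*} [NontriviallyNormedField 𝕜]
    [NormedAddCommGroup F] [NormedSpace 𝕜 F] (c : 𝕜) (f : 𝕜 → F) (n : ℕ) :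
    iteratedDeriv n (fun z => f (c * z)) = fun z => c ^ n • iteratedDeriv n f (c * z) := by
  induction n with
  | zero => simp
  | succ n ih =>
    ext z
    rw [iteratedDeriv_succ, ih, iteratedDeriv_succ, deriv_fun_const_smul_field,
      deriv_comp_mul_left, smul_smul, pow_succ]

/-- If `T` is continuous on the closed sector `Σ̄_{π−φ}`, holomorphic on
`Σ_{π−φ}`, and `{T(λ) : λ ∈ Σ_{π−φ}}` is R-bounded with `R_p`-bound `C`, then for every
`φ' ∈ (φ, π)` the family `{λ T'(λ) : λ ∈ Σ_{π−φ'}}` is R-bounded with `R_p`-bound at most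
`C / sin²(φ'−φ)`; consequently `{λ^k T^{(k)}(λ) : λ ∈ Σ_{π−φ'}}` is R-bounded for all `k`. -/
theorem stmt0 {X : Type*} [NormedAddCommGroup X] [NormedSpace ℂ X] [CompleteSpace X]
    (φ : ℝ) (hφ : φ ∈ Set.Ioo 0 Real.pi)
    (T : ℂ → X →L[ℂ] X)
    (hTc : ContinuousOn T (closure (sector (Real.pi - φ))))
    (hTh : DifferentiableOn ℂ T (sector (Real.pi - φ)))
    (p : ℝ) (hp : 1 ≤ p)
    (C : ℝ) (hC : 0 ≤ C)
    (hRb : IsRBoundedWith p (T '' sector (Real.pi - φ)) C) :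
    (∀ φ' ∈ Set.Ioo φ Real.pi,
        IsRBoundedWith p
          {S | ∃ l ∈ sector (Real.pi - φ'), S = l • deriv T l}
          (C / Real.sin (φ' - φ) ^ 2)) ∧
      ∀ k : ℕ, ∀ φ' ∈ Set.Ioo φ Real.pi,
        IsRBounded p {S | ∃ l ∈ sector (Real.pi - φ'), S = l ^ k • iteratedDeriv k T l} := by
  obtain ⟨hφ0, hφπ⟩ := hφ
  have hopen : IsOpen (sector (Real.pi - φ)) := isOpen_sector (by linarith)
  have hmul : ∀ {φ' : ℝ} {l z : ℂ}, l ∈ sector (Real.pi - φ') → z ∈ sector (φ' - φ) →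
      l * z ∈ sector (Real.pi - φ) := fun {φ' l z} hl hz => by
    have := mul_mem_sector (by linarith) hl hz
    rwa [show Real.pi - φ' + (φ' - φ) = Real.pi - φ by ring] at this
  refine ⟨fun φ' ⟨h1, h2⟩ => ?_, fun k φ' ⟨h1, h2⟩ => ?_⟩
  · intro N t ht x
    -- Cauchy estimate in logarithmic coordinates, on a disc inside a strip.
    choose l hl htl using ht
    set α := φ' - φ with hα
    have hα0 : 0 < α := by linarith
    have hs0 : 0 < Real.sin α := Real.sin_pos_of_pos_of_lt_pi hα0 (by linarith)
    have hr : Real.sin α ^ 2 < α := by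
      nlinarith [Real.sin_lt hα0, Real.sin_le_one α]
    have hmem : ∀ ν, ∀ z ∈ Metric.ball (0 : ℂ) α,
        l ν * Complex.exp z ∈ sector (Real.pi - φ) := fun ν z hz =>
      hmul (hl ν) (exp_mem_sector (by linarith)
        ((Complex.abs_im_le_norm z).trans_lt (by simpa using hz)))
    have key := hRb.radAvg_iteratedDeriv_le hp Metric.isOpen_ball
      (S := fun ν z => T (l ν * Complex.exp z))
      (fun ν => hTh.comp (by fun_prop) (hmem ν)) (pow_pos hs0 2)
      (Metric.closedBall_subset_ball hr) (fun ν z hz => ⟨_, hmem ν z hz, rfl⟩) 1 x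
    have hderiv : ∀ ν, deriv (fun z => T (l ν * Complex.exp z)) 0 = t ν := fun ν => by
      have hT : HasDerivAt T (deriv T (l ν)) (l ν * Complex.exp 0) := by
        have h0 := hmem ν 0 (Metric.mem_ball_self hα0)
        simpa using (hTh.differentiableAt (hopen.mem_nhds h0)).hasDerivAt
      have := (hT.scomp (0 : ℂ) ((Complex.hasDerivAt_exp 0).const_mul (l ν))).deriv
      rw [htl ν]
      simpa [Function.comp_def] using this
    simpa [hderiv] using key
  · have hsec : sector (φ' - φ) ∈ nhds (1 : ℂ) :=
      (isOpen_sector (by linarith)).mem_nhds ⟨one_ne_zero, by simpa using h1⟩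
    obtain ⟨r, hr, hball⟩ := Metric.nhds_basis_closedBall.mem_iff.1 hsec
    refine ⟨k.factorial * C / r ^ k, by positivity, fun N t ht x => ?_⟩
    choose l hl htl using ht
    have key := hRb.radAvg_iteratedDeriv_le hp (isOpen_sector (θ := φ' - φ) (by linarith))
      (S := fun ν z => T (l ν * z))
      (fun ν => hTh.comp (by fun_prop) (fun z hz => hmul (hl ν) hz)) hr hball
      (fun ν z hz => ⟨_, hmul (hl ν) hz, rfl⟩) k x
    simpa only [iteratedDeriv_comp_mul_left, mul_one, ← htl] using key

end
end

section
/- Let 1 < p < ∞ with conjugate exponent p′ = p/(p−1), let E be a Banach space, and let k : ℝ^n × (0,∞) × (0,∞) → ℂ be measurable with M := ( ∫₀^∞ ( ∫₀^∞ ( ∫_{ℝ^n} |k(x′, y, ȳ)| dx′ )^{p′} dȳ )^{p/p′} dy )^{1/p} < ∞. Then for every f ∈ L_p(ℝ^n × (0,∞); E), the integral (K f)(x′, y) := ∫₀^∞ ∫_{ℝ^n} k(x′ − x̄′, y, ȳ) f(x̄′, ȳ) dx̄′ dȳ converges absolutely (as a Bochner integral) for almost every (x′, y) ∈ ℝ^n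 × (0,∞), K f belongs to L_p(ℝ^n × (0,∞); E), and ‖K f‖_{L_p} ≤ M · ‖f‖_{L_p}; hence K defines a bounded linear operator on L_p(ℝ^n × (0,∞); E) with operator norm at most M. -/
noncomputable section

open MeasureTheory Set ENNReal

/-- Hölder's inequality with respect to a weight `w`. -/
theorem lintegral_mul_le_weighted {α : Type*} [MeasurableSpace α] (μ : Measure α) {p q : ℝ}
    (hpq : p.HolderConjugate q) {w f : α → ℝ≥0∞} (hw : Measurable w) (hf : Measurable f) :
    ∫⁻ a, w a * f a ∂μ ≤ (∫⁻ a, w a ∂μ) ^ (1 / q) * (∫⁻ a, w a * f a ^ p ∂μ) ^ (1 / p) := by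
  have hp := hpq.pos
  have hq := hpq.symm.pos
  have hsum : 1 / q + 1 / p = 1 := by
    simpa [add_comm] using hpq.inv_add_inv_eq_one
  have key := ENNReal.lintegral_mul_le_Lp_mul_Lq μ hpq.symm
    (f := fun a => w a ^ (1 / q)) (g := fun a => w a ^ (1 / p) * f a)
    (by fun_prop) (by fun_prop)
  have h₀ : ∀ a, w a ^ (1 / q) * (w a ^ (1 / p) * f a) = w a * f a := fun a => by
    rw [← mul_assoc, ← ENNReal.rpow_add_of_nonneg _ _ (by positivity) (by positivity), hsum,
      ENNReal.rpow_one]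
  have h₁ : ∀ a, (w a ^ (1 / q)) ^ q = w a := fun a => by
    rw [← ENNReal.rpow_mul, one_div_mul_cancel hq.ne', ENNReal.rpow_one]
  have h₂ : ∀ a, (w a ^ (1 / p) * f a) ^ p = w a * f a ^ p := fun a => by
    rw [ENNReal.mul_rpow_of_nonneg _ _ hp.le, ← ENNReal.rpow_mul, one_div_mul_cancel hp.ne',
      ENNReal.rpow_one]
  simpa only [Pi.mul_apply, h₀, h₁, h₂] using key

section MixedNorm

variable {X Y : Type*} [MeasurableSpace X] [AddCommGroup X] [MeasurableAdd₂ X] [MeasurableNeg X]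
  [MeasurableSpace Y] {μ : Measure X} [SFinite μ] [μ.IsAddLeftInvariant] [μ.IsNegInvariant]
  {ν : Measure Y} [SFinite ν] {p q : ℝ}

/-- The bound for a fixed first transversal variable: integration against a kernel which is a
convolution in `X` maps `L_p (X × Y)` to `L_p X`, with norm at most the mixed `(L_q, L_1)` norm of
the kernel. -/
theorem lintegral_rpow_convolution_slice_le (hpq : p.HolderConjugate q)
    {κ : X → Y → ℝ≥0∞} (hκ : Measurable (Function.uncurry κ))
    {F : X × Y → ℝ≥0∞} (hF : Measurable F)
    (hfin : ∫⁻ t, (∫⁻ x, κ x t ∂μ) ^ q ∂ν ≠ ∞) :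
    ∫⁻ x, (∫⁻ w, κ (x - w.1) w.2 * F w ∂μ.prod ν) ^ p ∂μ ≤
      (∫⁻ t, (∫⁻ x, κ x t ∂μ) ^ q ∂ν) ^ (p / q) * ∫⁻ w, F w ^ p ∂μ.prod ν := by
  have hp := hpq.pos
  have hq := hpq.symm.pos
  have hsum : 1 / q + 1 / p = 1 := by
    simpa [add_comm] using hpq.inv_add_inv_eq_one
  set h : Y → ℝ≥0∞ := fun t => ∫⁻ x, κ x t ∂μ
  have hh : Measurable h := hκ.lintegral_prod_left
  have hκ' : Measurable fun r : X × X × Y => κ (r.1 - r.2.1) r.2.2 :=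
    hκ.comp ((measurable_fst.sub measurable_snd.fst).prodMk measurable_snd.snd)
  set R : X → Y → ℝ≥0∞ := fun x t => ∫⁻ s, κ (x - s) t * F (s, t) ^ p ∂μ
  have hR : Measurable (Function.uncurry R) := by
    have : Measurable fun r : (X × Y) × X => κ (r.1.1 - r.2) r.1.2 * F (r.2, r.1.2) ^ p :=
      (hκ'.comp (measurable_fst.fst.prodMk (measurable_snd.prodMk measurable_fst.snd))).mul
        ((hF.comp (measurable_snd.prodMk measurable_fst.snd)).pow_const p)
    exact this.lintegral_prod_right'
  have h_top : ∀ᵐ t ∂ν, h t ≠ ∞ := by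
    filter_upwards [ae_lt_top (hh.pow_const q) hfin] with t ht ht'
    simp [ht', ENNReal.top_rpow_of_pos hq] at ht
  have pointwise : ∀ x, (∫⁻ w, κ (x - w.1) w.2 * F w ∂μ.prod ν) ^ p ≤
      (∫⁻ t, h t ^ q ∂ν) ^ (p / q) * ∫⁻ t, (h t)⁻¹ * R x t ∂ν := by
    intro x
    have hRx : Measurable (R x) := hR.comp measurable_prodMk_left
    have hκx : Measurable fun w : X × Y => κ (x - w.1) w.2 := hκ'.comp measurable_prodMk_left
    have inner : ∀ᵐ t ∂ν, ∫⁻ s, κ (x - s) t * F (s, t) ∂μ ≤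
        h t * ((h t)⁻¹ * R x t) ^ (1 / p) := by
      filter_upwards [h_top] with t ht
      have key := lintegral_mul_le_weighted μ hpq
        (w := fun s => κ (x - s) t) (f := fun s => F (s, t))
        (hκx.comp measurable_prodMk_right) (hF.comp measurable_prodMk_right)
      rw [lintegral_sub_left_eq_self (fun s => κ s t) x] at key
      refine key.trans ?_
      change h t ^ (1 / q) * R x t ^ (1 / p) ≤ _
      rcases eq_or_ne (h t) 0 with h0 | h0
      · simp [h0, ENNReal.zero_rpow_of_pos (inv_pos.2 hq)]
      · refine le_of_eq ?_
        have split : h t = h t ^ (1 / q) * h t ^ (1 / p) := by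
          rw [← ENNReal.rpow_add_of_nonneg _ _ (by positivity) (by positivity), hsum,
            ENNReal.rpow_one]
        conv_rhs => enter [1]; rw [split]
        rw [mul_assoc, ← ENNReal.mul_rpow_of_nonneg _ _ (by positivity), ← mul_assoc,
          ENNReal.mul_inv_cancel h0 ht, one_mul]
    have outer := ENNReal.lintegral_mul_le_Lp_mul_Lq ν hpq.symm
      (f := h) (g := fun t => ((h t)⁻¹ * R x t) ^ (1 / p)) (by fun_prop) (by fun_prop)
    have hpow : ∀ a : ℝ≥0∞, (a ^ (1 / p)) ^ p = a := fun a => by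
      rw [← ENNReal.rpow_mul, one_div_mul_cancel hp.ne', ENNReal.rpow_one]
    simp only [Pi.mul_apply, hpow] at outer
    rw [lintegral_prod_symm' (fun w : X × Y => κ (x - w.1) w.2 * F w) (hκx.mul hF)]
    calc (∫⁻ t, ∫⁻ s, κ (x - s) t * F (s, t) ∂μ ∂ν) ^ p
        ≤ ((∫⁻ t, h t ^ q ∂ν) ^ (1 / q) * (∫⁻ t, (h t)⁻¹ * R x t ∂ν) ^ (1 / p)) ^ p :=
          ENNReal.rpow_le_rpow ((lintegral_mono_ae inner).trans outer) hp.le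
      _ = _ := by
          rw [ENNReal.mul_rpow_of_nonneg _ _ hp.le, hpow, ← ENNReal.rpow_mul, one_div_mul_eq_div]
  have mass : ∀ t, ∫⁻ x, R x t ∂μ = h t * ∫⁻ s, F (s, t) ^ p ∂μ := by
    intro t
    have meas : Measurable fun r : X × X => κ (r.1 - r.2) t * F (r.2, t) ^ p :=
      (hκ'.comp (measurable_fst.prodMk (measurable_snd.prodMk measurable_const))).mul
        ((hF.comp (measurable_snd.prodMk measurable_const)).pow_const p)
    have hκt : ∀ s, Measurable fun x => κ (x - s) t := fun s =>
      hκ.comp ((measurable_id.sub_const s).prodMk measurable_const)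
    have hFt : Measurable fun s => F (s, t) ^ p :=
      (hF.comp measurable_prodMk_right).pow_const p
    rw [lintegral_lintegral_swap meas.aemeasurable]
    simp_rw [lintegral_mul_const _ (hκt _), lintegral_sub_right_eq_self (fun x => κ x t)]
    exact lintegral_const_mul _ hFt
  have meas_hR : Measurable fun r : X × Y => (h r.2)⁻¹ * R r.1 r.2 :=
    (hh.comp measurable_snd).inv.mul hR
  calc ∫⁻ x, (∫⁻ w, κ (x - w.1) w.2 * F w ∂μ.prod ν) ^ p ∂μ
      ≤ ∫⁻ x, (∫⁻ t, h t ^ q ∂ν) ^ (p / q) * ∫⁻ t, (h t)⁻¹ * R x t ∂ν ∂μ :=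
        lintegral_mono pointwise
    _ = (∫⁻ t, h t ^ q ∂ν) ^ (p / q) * ∫⁻ t, (h t)⁻¹ * (h t * ∫⁻ s, F (s, t) ^ p ∂μ) ∂ν := by
        rw [lintegral_const_mul _ meas_hR.lintegral_prod_right',
          lintegral_lintegral_swap meas_hR.aemeasurable]
        congr 1
        refine lintegral_congr fun t => ?_
        rw [← mass t]
        have hRt : Measurable fun x => R x t := hR.comp measurable_prodMk_right
        exact lintegral_const_mul (h t)⁻¹ hRt
    _ ≤ (∫⁻ t, h t ^ q ∂ν) ^ (p / q) * ∫⁻ w, F w ^ p ∂μ.prod ν := by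
        rw [lintegral_prod_symm' _ (hF.pow_const p)]
        gcongr with t
        rw [← mul_assoc]
        exact mul_le_of_le_one_left' (ENNReal.inv_mul_le_one _)

/-- The `L_p` bound for a kernel which is a convolution in `X`, in terms of its mixed
`(L_p, L_q, L_1)` norm. -/
theorem lintegral_rpow_convolution_le (hpq : p.HolderConjugate q)
    {κ : X → Y → Y → ℝ≥0∞} (hκ : Measurable fun r : X × Y × Y => κ r.1 r.2.1 r.2.2)
    {F : X × Y → ℝ≥0∞} (hF : Measurable F)
    (hfin : ∫⁻ y, (∫⁻ t, (∫⁻ x, κ x y t ∂μ) ^ q ∂ν) ^ (p / q) ∂ν ≠ ∞) :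
    ∫⁻ z, (∫⁻ w, κ (z.1 - w.1) z.2 w.2 * F w ∂μ.prod ν) ^ p ∂μ.prod ν ≤
      (∫⁻ y, (∫⁻ t, (∫⁻ x, κ x y t ∂μ) ^ q ∂ν) ^ (p / q) ∂ν) * ∫⁻ w, F w ^ p ∂μ.prod ν := by
  have hH : Measurable fun y => (∫⁻ t, (∫⁻ x, κ x y t ∂μ) ^ q ∂ν) ^ (p / q) := by
    have h₁ : Measurable fun r : Y × Y => ∫⁻ x, κ x r.1 r.2 ∂μ := hκ.lintegral_prod_left'
    exact ((h₁.pow_const q).lintegral_prod_right').pow_const _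
  have hker : Measurable fun r : (X × Y) × X × Y =>
      κ (r.1.1 - r.2.1) r.1.2 r.2.2 * F r.2 :=
    (hκ.comp ((measurable_fst.fst.sub measurable_snd.fst).prodMk
      (measurable_fst.snd.prodMk measurable_snd.snd))).mul (hF.comp measurable_snd)
  rw [lintegral_prod_symm' _ (hker.lintegral_prod_right'.pow_const p), ← lintegral_mul_const _ hH]
  refine lintegral_mono_ae ?_
  filter_upwards [ae_lt_top hH hfin] with y hy
  refine lintegral_rpow_convolution_slice_le hpq (κ := fun x t => κ x y t)
    (hκ.comp (measurable_fst.prodMk (measurable_const.prodMk measurable_snd))) hF ?_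
  intro htop
  simp [htop, ENNReal.top_rpow_of_pos (div_pos hpq.pos hpq.symm.pos)] at hy

end MixedNorm

/-- If the `L_p` norm of the absolute integral `∫ ‖κ z w • f w‖ dw` is at most `M ‖f‖`, then the
integrals converge absolutely almost everywhere and define an element of `L_p` of norm at most
`M ‖f‖`. -/
theorem exists_Lp_integral_operator {α E : Type*} [MeasurableSpace α] [NormedAddCommGroup E]
    [NormedSpace ℂ E] {μ : Measure α} [SFinite μ] {p : ℝ} (hp : 0 < p)
    {κ : α → α → ℂ} (hκ : Measurable (Function.uncurry κ)) {M : ℝ} (hM0 : 0 ≤ M)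
    (f : Lp E (ENNReal.ofReal p) μ)
    (bound : (∫⁻ z, (∫⁻ w, ‖κ z w‖ₑ * ‖f w‖ₑ ∂μ) ^ p ∂μ) ^ (1 / p) ≤
      ENNReal.ofReal M * (∫⁻ w, ‖f w‖ₑ ^ p ∂μ) ^ (1 / p)) :
    (∀ᵐ z ∂μ, Integrable (fun w => κ z w • f w) μ) ∧
      ∃ g : Lp E (ENNReal.ofReal p) μ, (∀ᵐ z ∂μ, g z = ∫ w, κ z w • f w ∂μ) ∧
        ‖g‖ ≤ M * ‖f‖ := by
  have hP0 : ENNReal.ofReal p ≠ 0 := by simpa using hp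
  have hnorm : ∀ u : α → E,
      eLpNorm u (ENNReal.ofReal p) μ = (∫⁻ w, ‖u w‖ₑ ^ p ∂μ) ^ (1 / p) := fun u => by
    rw [eLpNorm_eq_lintegral_rpow_enorm_toReal hP0 ENNReal.ofReal_ne_top,
      ENNReal.toReal_ofReal hp.le]
  have hker : StronglyMeasurable fun r : α × α => κ r.1 r.2 • f r.2 :=
    hκ.stronglyMeasurable.smul ((Lp.stronglyMeasurable f).comp_measurable measurable_snd)
  rw [← hnorm] at bound
  simp only [← enorm_smul] at bound
  have bound_lt_top : ENNReal.ofReal M * eLpNorm f (ENNReal.ofReal p) μ < ∞ :=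
    ENNReal.mul_lt_top ENNReal.ofReal_lt_top (Lp.eLpNorm_lt_top f)
  have lintegral_ne_top : ∫⁻ z, (∫⁻ w, ‖κ z w • f w‖ₑ ∂μ) ^ p ∂μ ≠ ∞ := by
    intro htop
    rw [htop, ENNReal.top_rpow_of_pos (by positivity)] at bound
    exact (bound.trans_lt bound_lt_top).ne rfl
  have hint : ∀ᵐ z ∂μ, Integrable (fun w => κ z w • f w) μ := by
    filter_upwards [ae_lt_top (hker.enorm.lintegral_prod_right'.pow_const p) lintegral_ne_top]
      with z hz
    exact ⟨(hker.comp_measurable measurable_prodMk_left).aestronglyMeasurable,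
      (ENNReal.rpow_lt_top_iff_of_pos hp).1 hz⟩
  have hle : eLpNorm (fun z => ∫ w, κ z w • f w ∂μ) (ENNReal.ofReal p) μ ≤
      ENNReal.ofReal M * eLpNorm f (ENNReal.ofReal p) μ := by
    refine le_trans ?_ bound
    rw [hnorm]
    gcongr with z
    exact enorm_integral_le_lintegral_enorm _
  have hmem : MemLp (fun z => ∫ w, κ z w • f w ∂μ) (ENNReal.ofReal p) μ :=
    ⟨hker.integral_prod_right'.aestronglyMeasurable, hle.trans_lt bound_lt_top⟩
  refine ⟨hint, hmem.toLp _, hmem.coeFn_toLp, ?_⟩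
  rw [Lp.norm_toLp, Lp.norm_def, ← ENNReal.toReal_ofReal hM0, ← ENNReal.toReal_mul]
  exact ENNReal.toReal_mono bound_lt_top.ne hle

/-- A linear map between `L_p` spaces can be built from a pointwise almost everywhere defined
integral operator which is bounded and whose integrals converge absolutely. -/
theorem exists_clm_of_integral_operator {α E : Type*} [MeasurableSpace α] [NormedAddCommGroup E]
    [NormedSpace ℂ E] {μ : Measure α} {P : ℝ≥0∞} [Fact (1 ≤ P)] (κ : α → α → ℂ) {M : ℝ}
    (hM0 : 0 ≤ M)
    (H : ∀ f : Lp E P μ, (∀ᵐ z ∂μ, Integrable (fun w => κ z w • (f : α → E) w) μ) ∧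
      ∃ g : Lp E P μ, (∀ᵐ z ∂μ, (g : α → E) z = ∫ w, κ z w • (f : α → E) w ∂μ) ∧
        ‖g‖ ≤ M * ‖f‖) :
    ∃ K : Lp E P μ →L[ℂ] Lp E P μ, ‖K‖ ≤ M ∧
      ∀ f : Lp E P μ, ∀ᵐ z ∂μ, (K f : α → E) z = ∫ w, κ z w • (f : α → E) w ∂μ := by
  choose hint T hT hbound using H
  let L : Lp E P μ →ₗ[ℂ] Lp E P μ :=
    { toFun := T
      map_add' := fun f g => by
        refine Lp.ext ?_
        filter_upwards [hT (f + g), hT f, hT g, Lp.coeFn_add (T f) (T g), hint f, hint g]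
          with z h₁ h₂ h₃ h₄ h₅ h₆
        rw [h₁, h₄, Pi.add_apply, h₂, h₃, ← integral_add h₅ h₆]
        refine integral_congr_ae ?_
        filter_upwards [Lp.coeFn_add f g] with w hw
        rw [hw, Pi.add_apply, smul_add]
      map_smul' := fun c f => by
        refine Lp.ext ?_
        filter_upwards [hT (c • f), hT f, Lp.coeFn_smul c (T f)] with z h₁ h₂ h₃
        rw [h₁, RingHom.id_apply, h₃, Pi.smul_apply, h₂, ← integral_smul]
        refine integral_congr_ae ?_
        filter_upwards [Lp.coeFn_smul c f] with w hw
        rw [hw, Pi.smul_apply, smul_comm] }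
  exact ⟨L.mkContinuous M hbound, L.mkContinuous_norm_le hM0 _, hT⟩

/-- A convolution-type kernel operator on the half-space
`ℝ^n × (0,∞)` whose kernel has finite mixed `(L_p in y, L_{p'} in ȳ, L_1 in x')` norm `M`
defines a bounded operator on `L_p(ℝ^n × (0,∞); E)` of norm at most `M`. -/
theorem stmt12 {E : Type*} [NormedAddCommGroup E] [NormedSpace ℂ E] [CompleteSpace E]
    (n : ℕ) (p : ℝ) (hp : 1 < p) [Fact (1 ≤ ENNReal.ofReal p)]
    (μ : Measure ((Fin n → ℝ) × ℝ))
    (hμ : μ = (volume : Measure (Fin n → ℝ)).prod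
      ((volume : Measure ℝ).restrict (Ioi (0 : ℝ))))
    (k : (Fin n → ℝ) → ℝ → ℝ → ℂ)
    (hk : Measurable fun q : (Fin n → ℝ) × ℝ × ℝ => k q.1 q.2.1 q.2.2)
    (M : ℝ) (hM0 : 0 ≤ M)
    (hM : ENNReal.ofReal M =
      (∫⁻ y in Ioi (0 : ℝ),
          (∫⁻ yb in Ioi (0 : ℝ),
              (∫⁻ x', (‖k x' y yb‖₊ : ℝ≥0∞)) ^ (p / (p - 1)) ) ^ (p / (p / (p - 1)))
        ) ^ (1 / p)) :
    (∀ f : Lp E (ENNReal.ofReal p) μ,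
        (∀ᵐ z ∂μ, Integrable
            (fun w => k (z.1 - w.1) z.2 w.2 • (f : (Fin n → ℝ) × ℝ → E) w) μ) ∧
        ∃ g : Lp E (ENNReal.ofReal p) μ,
          (∀ᵐ z ∂μ, (g : (Fin n → ℝ) × ℝ → E) z
              = ∫ w, k (z.1 - w.1) z.2 w.2 • (f : (Fin n → ℝ) × ℝ → E) w ∂μ) ∧
          ‖g‖ ≤ M * ‖f‖) ∧
      ∃ K : Lp E (ENNReal.ofReal p) μ →L[ℂ] Lp E (ENNReal.ofReal p) μ,
        ‖K‖ ≤ M ∧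
        ∀ f : Lp E (ENNReal.ofReal p) μ, ∀ᵐ z ∂μ,
          (K f : (Fin n → ℝ) × ℝ → E) z
            = ∫ w, k (z.1 - w.1) z.2 w.2 • (f : (Fin n → ℝ) × ℝ → E) w ∂μ := by
  have hpq : p.HolderConjugate (p / (p - 1)) := .conjExponent hp
  have hp0 : 0 < p := hpq.pos
  simp only [← enorm_eq_nnnorm] at hM
  have hMfin : (∫⁻ y in Ioi (0 : ℝ), (∫⁻ yb in Ioi (0 : ℝ),
      (∫⁻ x', ‖k x' y yb‖ₑ) ^ (p / (p - 1))) ^ (p / (p / (p - 1)))) ≠ ∞ := by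
    intro htop
    rw [htop, ENNReal.top_rpow_of_pos (by positivity)] at hM
    exact ENNReal.ofReal_ne_top hM
  have main : ∀ f : Lp E (ENNReal.ofReal p) μ,
      (∀ᵐ z ∂μ, Integrable
          (fun w => k (z.1 - w.1) z.2 w.2 • (f : (Fin n → ℝ) × ℝ → E) w) μ) ∧
      ∃ g : Lp E (ENNReal.ofReal p) μ,
        (∀ᵐ z ∂μ, (g : (Fin n → ℝ) × ℝ → E) z
            = ∫ w, k (z.1 - w.1) z.2 w.2 • (f : (Fin n → ℝ) × ℝ → E) w ∂μ) ∧
        ‖g‖ ≤ M * ‖f‖ := by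
    subst hμ
    intro f
    have hker : Measurable fun r : ((Fin n → ℝ) × ℝ) × (Fin n → ℝ) × ℝ =>
        k (r.1.1 - r.2.1) r.1.2 r.2.2 :=
      hk.comp ((measurable_fst.fst.sub measurable_snd.fst).prodMk
        (measurable_fst.snd.prodMk measurable_snd.snd))
    refine exists_Lp_integral_operator
      (κ := fun z w : (Fin n → ℝ) × ℝ => k (z.1 - w.1) z.2 w.2) hp0 hker hM0 f ?_
    rw [hM, ← ENNReal.mul_rpow_of_nonneg _ _ (by positivity)]
    refine ENNReal.rpow_le_rpow ?_ (by positivity)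
    exact lintegral_rpow_convolution_le hpq (κ := fun x y t => ‖k x y t‖ₑ)
      hk.enorm (Lp.stronglyMeasurable f).enorm hMfin
  exact ⟨main, exists_clm_of_integral_operator
    (fun z w : (Fin n → ℝ) × ℝ => k (z.1 - w.1) z.2 w.2) hM0 main⟩

end
end
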